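/- The function h := inf_{n≥0} h_n and each h_n for n ≥ 1 are bijective as maps [0,1] → [0,1], strictly decreasing, and convex. -/

import Mathlib

open Set MeasureTheory Polynomial

noncomputable section

/-- The class `E` of antitone functions `g : [0,1] → [0,1]` with `g 0 = 1` and
positive integral (functions are modelled as total functions `ℝ → ℝ`,
constrained on `[0,1]`). -/
def E : Set (ℝ → ℝ) :=
  {g | AntitoneOn g (Icc 0 1) ∧ MapsTo g (Icc 0 1) (Icc 0 1) ∧ g 0 = 1 ∧
    0 < ∫ x in (0:ℝ)..1, g x}

/-- The pseudo-inverse `g*` of `g`, given by `g* y = sup {x ∈ [0,1] | g x ≥ y}`. -/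
def pseudoInv (g : ℝ → ℝ) : ℝ → ℝ := fun y => sSup {x | x ∈ Icc (0:ℝ) 1 ∧ y ≤ g x}

/-- The stribolic operator `T`, `(T g) x = (∫_x^1 g*) / (∫_0^1 g)`. -/
def T (g : ℝ → ℝ) : ℝ → ℝ := fun x =>
  (∫ t in x..(1:ℝ), pseudoInv g t) / (∫ t in (0:ℝ)..1, g t)

/-- The canonical stribolic iterates: `h 0 = 1` and `h (n+1) = T (h n)`. -/
def h : ℕ → ℝ → ℝ
  | 0 => fun _ => 1
  | n + 1 => T (h n)

/-- `κ n = ∫_0^1 h n`. -/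
def κ (n : ℕ) : ℝ := ∫ t in (0:ℝ)..1, h n t

/-- The compositions `q n = h n ∘ ⋯ ∘ h 1`, with `q 0 = id`. -/
def q : ℕ → ℝ → ℝ
  | 0 => fun x => x
  | n + 1 => h (n + 1) ∘ q n

/-- `q (n-1)`, with the convention that for `n = 0` (i.e. "`q (-1)`") it is the
constant function `1` (the only convention making the `n = 0` cases hold). -/
def qprev : ℕ → ℝ → ℝ
  | 0 => fun _ => 1
  | n + 1 => q n

/-- `Q n x = ∫_0^x (q n)' (t) * q (n-1) (t) dt`. -/
def Q (n : ℕ) (x : ℝ) : ℝ := ∫ t in (0:ℝ)..x, deriv (q n) t * qprev n t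

lemma pseudoInv_mem {g : ℝ → ℝ} (y : ℝ) : pseudoInv g y ∈ Icc (0 : ℝ) 1 :=
  ⟨Real.sSup_nonneg fun _ hx => hx.1.1, Real.sSup_le (fun _ hx => hx.1.2) zero_le_one⟩

lemma le_pseudoInv {g : ℝ → ℝ} {x y : ℝ} (hx : x ∈ Icc (0 : ℝ) 1) (hy : y ≤ g x) :
    x ≤ pseudoInv g y :=
  le_csSup ⟨1, fun _ hz => hz.1.2⟩ ⟨hx, hy⟩

lemma antitone_pseudoInv (g : ℝ → ℝ) : Antitone (pseudoInv g) := fun y₁ _ hy =>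
  Real.sSup_le (fun _ hx => le_pseudoInv hx.1 (hy.trans hx.2)) (pseudoInv_mem y₁).1

lemma pseudoInv_eq_zero {g : ℝ → ℝ} (hg : g ∈ E) {y : ℝ} (hy : 1 < y) : pseudoInv g y = 0 :=
  le_antisymm (Real.sSup_le (fun _ hx => absurd ((hx.2.trans (hg.2.1 hx.1).2).trans_lt hy)
    (lt_irrefl y)) le_rfl) (pseudoInv_mem y).1

lemma le_of_lt_pseudoInv {g : ℝ → ℝ} (hg : g ∈ E) {x y : ℝ} (hx : 0 ≤ x)
    (h : x < pseudoInv g y) : y ≤ g x := by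
  have hne : {z | z ∈ Icc (0 : ℝ) 1 ∧ y ≤ g z}.Nonempty := by
    by_contra hne
    rw [not_nonempty_iff_eq_empty] at hne
    rw [pseudoInv, hne, Real.sSup_empty] at h
    exact absurd h hx.not_gt
  obtain ⟨z, hz, hxz⟩ := exists_lt_of_lt_csSup hne h
  exact hz.2.trans (hg.1 ⟨hx, hxz.le.trans hz.1.2⟩ hz.1 hxz.le)

lemma lt_of_pseudoInv_lt {g : ℝ → ℝ} (hg : ∀ x, 1 ≤ x → g x = 0) {x y : ℝ} (hx : 0 ≤ x)
    (hy : 0 < y) (h : pseudoInv g y < x) : g x < y := by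
  rcases le_or_gt x 1 with h1 | h1
  · by_contra! hc
    exact absurd (le_pseudoInv ⟨hx, h1⟩ hc) h.not_ge
  · rwa [hg x h1.le]

lemma intervalIntegrable_pseudoInv (g : ℝ → ℝ) (a b : ℝ) :
    IntervalIntegrable (pseudoInv g) volume a b :=
  (antitone_pseudoInv g).intervalIntegrable

lemma integral_pseudoInv_of_one_le {g : ℝ → ℝ} (hg : g ∈ E) {M : ℝ} (hM : 1 ≤ M) (x : ℝ) :
    ∫ t in x..M, pseudoInv g t = ∫ t in x..1, pseudoInv g t := by
  rw [← intervalIntegral.integral_add_adjacent_intervals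
    (intervalIntegrable_pseudoInv g x 1) (intervalIntegrable_pseudoInv g 1 M),
    intervalIntegral.integral_of_le hM,
    setIntegral_eq_zero_of_forall_eq_zero fun t ht => pseudoInv_eq_zero hg ht.1, add_zero]

lemma intervalIntegrable_of_mem_E {g : ℝ → ℝ} (hg : g ∈ E) :
    IntervalIntegrable g volume 0 1 :=
  AntitoneOn.intervalIntegrable (by rw [uIcc_of_le zero_le_one]; exact hg.1)

lemma integral_pseudoInv {g : ℝ → ℝ} (hg : g ∈ E) :
    ∫ t in (0 : ℝ)..1, pseudoInv g t = ∫ t in (0 : ℝ)..1, g t := by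
  have hint : Integrable g (volume.restrict (Ioc 0 1)) := (intervalIntegrable_of_mem_E hg).1
  have hnn : 0 ≤ᵐ[volume.restrict (Ioc 0 1)] g := by
    filter_upwards [ae_restrict_mem measurableSet_Ioc] with x hx
    exact (hg.2.1 ⟨hx.1.le, hx.2⟩).1
  rw [intervalIntegral.integral_of_le zero_le_one, intervalIntegral.integral_of_le zero_le_one,
    hint.integral_eq_integral_meas_le hnn]
  have hmeas : ∀ t ∈ Ioi (0 : ℝ),
      (volume.restrict (Ioc 0 1)).real {a : ℝ | t ≤ g a} = pseudoInv g t := by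
    intro t _
    have h1 : Ioo 0 (pseudoInv g t) ⊆ {a : ℝ | t ≤ g a} ∩ Ioc 0 1 := fun x hx =>
      ⟨le_of_lt_pseudoInv hg hx.1.le hx.2, hx.1, hx.2.le.trans (pseudoInv_mem t).2⟩
    have h2 : {a : ℝ | t ≤ g a} ∩ Ioc 0 1 ⊆ Ioc 0 (pseudoInv g t) := fun x hx =>
      ⟨hx.2.1, le_pseudoInv ⟨hx.2.1.le, hx.2.2⟩ hx.1⟩
    have h3 : volume ({a : ℝ | t ≤ g a} ∩ Ioc 0 1) = ENNReal.ofReal (pseudoInv g t) := by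
      apply le_antisymm
      · simpa using measure_mono (μ := volume) h2
      · simpa using measure_mono (μ := volume) h1
    rw [Measure.real, Measure.restrict_apply' measurableSet_Ioc, h3,
      ENNReal.toReal_ofReal (pseudoInv_mem t).1]
  rw [setIntegral_congr_fun measurableSet_Ioi hmeas]
  refine (setIntegral_eq_of_subset_of_forall_sdiff_eq_zero measurableSet_Ioi
    Ioc_subset_Ioi_self fun t ht => pseudoInv_eq_zero hg ?_).symm
  by_contra! hc
  exact ht.2 ⟨ht.1, hc⟩

lemma T_eq_zero {g : ℝ → ℝ} (hg : g ∈ E) {x : ℝ} (hx : 1 ≤ x) : T g x = 0 := by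
  rw [T, intervalIntegral.integral_symm, integral_pseudoInv_of_one_le hg hx]
  simp

lemma T_zero {g : ℝ → ℝ} (hg : g ∈ E) : T g 0 = 1 := by
  rw [T, integral_pseudoInv hg, div_self hg.2.2.2.ne']

lemma T_sub {g : ℝ → ℝ} (x y : ℝ) :
    T g x - T g y = (∫ t in x..y, pseudoInv g t) / ∫ t in (0 : ℝ)..1, g t := by
  rw [T, T, ← sub_div, ← intervalIntegral.integral_add_adjacent_intervals
    (intervalIntegrable_pseudoInv g x y) (intervalIntegrable_pseudoInv g y 1), add_sub_cancel_right]

lemma antitone_T {g : ℝ → ℝ} (hg : g ∈ E) : Antitone (T g) := fun x y hxy => by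
  rw [← sub_nonneg, T_sub]
  exact div_nonneg (intervalIntegral.integral_nonneg hxy fun t _ => (pseudoInv_mem t).1)
    hg.2.2.2.le

lemma continuous_T (g : ℝ → ℝ) : Continuous (T g) := by
  have : T g = fun x => (-∫ t in (1 : ℝ)..x, pseudoInv g t) / ∫ t in (0 : ℝ)..1, g t := by
    ext x
    rw [T, intervalIntegral.integral_symm]
  rw [this]
  exact (intervalIntegral.continuous_primitive
    (fun a b => intervalIntegrable_pseudoInv g a b) 1).neg.div_const _

lemma T_mem_E {g : ℝ → ℝ} (hg : g ∈ E) : T g ∈ E := by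
  have hmaps : MapsTo (T g) (Icc 0 1) (Icc 0 1) := fun x hx =>
    ⟨(T_eq_zero hg le_rfl).symm.trans_le (antitone_T hg hx.2),
      (antitone_T hg hx.1).trans_eq (T_zero hg)⟩
  refine ⟨(antitone_T hg).antitoneOn _, hmaps, T_zero hg, ?_⟩
  refine intervalIntegral.integral_pos zero_lt_one (continuous_T g).continuousOn
    (fun x hx => (hmaps ⟨hx.1.le, hx.2⟩).1) ⟨0, left_mem_Icc.2 zero_le_one, ?_⟩
  rw [T_zero hg]
  exact zero_lt_one

lemma convexOn_T {g : ℝ → ℝ} (hg : g ∈ E) : ConvexOn ℝ (Icc 0 1) (T g) := by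
  refine convexOn_of_slope_mono_adjacent (convex_Icc 0 1) fun {x y z} _ _ hxy hyz => ?_
  have h1 : (y - x) * pseudoInv g y ≤ ∫ t in x..y, pseudoInv g t := by
    have := intervalIntegral.integral_mono_on hxy.le intervalIntegrable_const
      (intervalIntegrable_pseudoInv g x y) fun t ht => antitone_pseudoInv g ht.2
    simpa using this
  have h2 : ∫ t in y..z, pseudoInv g t ≤ (z - y) * pseudoInv g y := by
    have := intervalIntegral.integral_mono_on hyz.le (intervalIntegrable_pseudoInv g y z)
      intervalIntegrable_const fun t ht => antitone_pseudoInv g ht.1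
    simpa using this
  have hk := hg.2.2.2
  have e1 : T g y - T g x ≤ -((y - x) * pseudoInv g y / ∫ t in (0 : ℝ)..1, g t) := by
    rw [← neg_sub, T_sub]
    gcongr
  have e2 : -((z - y) * pseudoInv g y / ∫ t in (0 : ℝ)..1, g t) ≤ T g z - T g y := by
    rw [← neg_sub (T g y), T_sub]
    gcongr
  calc (T g y - T g x) / (y - x)
      ≤ -((y - x) * pseudoInv g y / ∫ t in (0 : ℝ)..1, g t) / (y - x) :=
        div_le_div_of_nonneg_right e1 (sub_pos.2 hxy).le
    _ = -((z - y) * pseudoInv g y / ∫ t in (0 : ℝ)..1, g t) / (z - y) := by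
        have := sub_pos.2 hxy
        have := sub_pos.2 hyz
        field_simp
    _ ≤ _ := div_le_div_of_nonneg_right e2 (sub_pos.2 hyz).le

/-- For all positive `a` and `b`, the signs of `b * f (a * x) - g x` on `(0, ∞)` change at most
from `+` to `-` and then back to `+`. -/
def CrossesTwice (f g : ℝ → ℝ) : Prop :=
  ∀ ⦃a b x₁ x₂ x₃ : ℝ⦄, 0 < a → 0 < b → 0 < x₁ → x₁ < x₂ → x₂ < x₃ →
    b * f (a * x₁) < g x₁ → g x₂ < b * f (a * x₂) → g x₃ ≤ b * f (a * x₃)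

lemma exists_neg_of_integral_neg {φ : ℝ → ℝ} {u v : ℝ} (huv : u ≤ v)
    (hφ : ∫ t in u..v, φ t < 0) : ∃ t ∈ Ioc u v, φ t < 0 := by
  by_contra! hc
  rw [intervalIntegral.integral_of_le huv] at hφ
  exact absurd (setIntegral_nonneg measurableSet_Ioc hc) hφ.not_ge

lemma exists_pos_of_integral_pos {φ : ℝ → ℝ} {u v : ℝ} (huv : u ≤ v)
    (hφ : 0 < ∫ t in u..v, φ t) : ∃ t ∈ Ioc u v, 0 < φ t := by
  obtain ⟨t, ht, hlt⟩ := exists_neg_of_integral_neg (φ := fun t => -φ t) huv (by simpa using hφ)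
  exact ⟨t, ht, neg_lt_zero.1 hlt⟩

/-- The difference of two rescaled images under `T` is a tail integral of a difference of
rescaled pseudo-inverses. -/
lemma exists_integral_eq {f g : ℝ → ℝ} (hf : f ∈ E) (hg : g ∈ E) {a b : ℝ} (ha : 0 < a)
    (hb : 0 < b) : ∃ c M k : ℝ, 0 < c ∧ 1 ≤ M ∧ 0 < k ∧
      (∀ u v, IntervalIntegrable (fun t => c * pseudoInv f (a * t) - pseudoInv g t) volume u v) ∧
      ∀ x, ∫ t in x..M, (c * pseudoInv f (a * t) - pseudoInv g t) =
        k * (b * T f (a * x) - T g x) := by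
  have hkf := hf.2.2.2
  have hkg := hg.2.2.2
  set kf := ∫ t in (0 : ℝ)..1, f t with hkf_def
  set kg := ∫ t in (0 : ℝ)..1, g t with hkg_def
  have hif : ∀ u v, IntervalIntegrable (fun t => pseudoInv f (a * t)) volume u v := fun u v =>
    ((antitone_pseudoInv f).comp_monotone
      (monotone_id.const_mul ha.le)).intervalIntegrable
  refine ⟨kg * b * a / kf, max 1 (1 / a), kg, by positivity, le_max_left _ _, hkg,
    fun u v => ((hif u v).const_mul _).sub (intervalIntegrable_pseudoInv g u v), fun x => ?_⟩
  have haM : 1 ≤ a * max 1 (1 / a) := by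
    calc 1 = a * (1 / a) := by field_simp
      _ ≤ _ := by gcongr; exact le_max_right _ _
  rw [intervalIntegral.integral_sub ((hif _ _).const_mul _) (intervalIntegrable_pseudoInv g _ _),
    intervalIntegral.integral_const_mul,
    intervalIntegral.integral_comp_mul_left (fun t => pseudoInv f t) ha.ne',
    integral_pseudoInv_of_one_le hf haM, integral_pseudoInv_of_one_le hg (le_max_left _ _), T, T,
    ← hkf_def, ← hkg_def, smul_eq_mul]
  field_simp

lemma CrossesTwice.map_T {f g : ℝ → ℝ} (hf : f ∈ E) (hg : g ∈ E)
    (hfg : CrossesTwice (pseudoInv f) (pseudoInv g)) : CrossesTwice (T f) (T g) := by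
  intro a b x₁ x₂ x₃ ha hb hx₁ h12 h23 h1 h2
  by_contra! h3
  obtain ⟨c, M, k, hc, hM, hk, hint, heq⟩ := exists_integral_eq hf hg ha hb
  have hx₃ : x₃ ≤ M := by
    by_contra! hlt
    have hx1 : 1 ≤ x₃ := hM.trans hlt.le
    rw [T_eq_zero hg hx1] at h3
    have h0 : T f 1 = 0 := T_eq_zero hf le_rfl
    have : 0 ≤ T f (a * x₃) := by
      rcases le_total (a * x₃) 1 with h | h
      · exact h0.symm.trans_le (antitone_T hf h)
      · exact (T_eq_zero hf h).ge
    exact absurd (mul_nonneg hb.le this) h3.not_ge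
  have e1 := mul_neg_of_pos_of_neg hk (sub_neg.2 h1)
  have e2 := mul_pos hk (sub_pos.2 h2)
  have e3 := mul_neg_of_pos_of_neg hk (sub_neg.2 h3)
  rw [← heq] at e1 e2 e3
  have s1 := intervalIntegral.integral_add_adjacent_intervals (hint x₁ x₂) (hint x₂ M)
  have s2 := intervalIntegral.integral_add_adjacent_intervals (hint x₂ x₃) (hint x₃ M)
  obtain ⟨t₁, ht₁, hn₁⟩ := exists_neg_of_integral_neg h12.le (by linarith)
  obtain ⟨t₂, ht₂, hn₂⟩ := exists_pos_of_integral_pos h23.le (by linarith)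
  obtain ⟨t₃, ht₃, hn₃⟩ := exists_neg_of_integral_neg hx₃ e3
  exact absurd (hfg ha hc (hx₁.trans ht₁.1) (ht₁.2.trans_lt ht₂.1) (ht₂.2.trans_lt ht₃.1)
    (sub_neg.1 hn₁) (sub_pos.1 hn₂)) (sub_neg.1 hn₃).not_ge

lemma mul_pseudoInv_lt {f g : ℝ → ℝ} (hf : ∀ x, 1 ≤ x → f x = 0) (hg : g ∈ E) {b y z : ℝ}
    (hb : 0 < b) (hz : 0 < z) (h : b * pseudoInv f z < pseudoInv g y) :
    ∃ x, b * pseudoInv f z < x ∧ x < pseudoInv g y ∧ f (b⁻¹ * x) < z ∧ y ≤ g x := by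
  obtain ⟨x, h1, h2⟩ := exists_between h
  have hx : 0 ≤ x := (mul_nonneg hb.le (pseudoInv_mem z).1).trans h1.le
  exact ⟨x, h1, h2, lt_of_pseudoInv_lt hf (by positivity) hz
    ((lt_inv_mul_iff₀ hb).2 h1), le_of_lt_pseudoInv hg hx h2⟩

lemma lt_mul_pseudoInv {f g : ℝ → ℝ} (hf : f ∈ E) (hg : ∀ x, 1 ≤ x → g x = 0) {b y z : ℝ}
    (hb : 0 < b) (hy : 0 < y) (h : pseudoInv g y < b * pseudoInv f z) :
    ∃ x, pseudoInv g y < x ∧ x < b * pseudoInv f z ∧ g x < y ∧ z ≤ f (b⁻¹ * x) := by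
  obtain ⟨x, h1, h2⟩ := exists_between h
  have hx : 0 ≤ x := (pseudoInv_mem y).1.trans h1.le
  exact ⟨x, h1, h2, lt_of_pseudoInv_lt hg hx hy h1,
    le_of_lt_pseudoInv hf (by positivity) ((inv_mul_lt_iff₀ hb).2 h2)⟩

lemma CrossesTwice.map_pseudoInv {f g : ℝ → ℝ} (hf : f ∈ E) (hg : g ∈ E)
    (hf0 : ∀ x, 1 ≤ x → f x = 0) (hg0 : ∀ x, 1 ≤ x → g x = 0) (hfg : CrossesTwice f g) :
    CrossesTwice (pseudoInv f) (pseudoInv g) := by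
  intro a b y₁ y₂ y₃ ha hb hy₁ h12 h23 h1 h2
  by_contra! h3
  have hy₂ := hy₁.trans h12
  have hy₃ := hy₂.trans h23
  obtain ⟨x₃, l3, u3, f3, g3⟩ := mul_pseudoInv_lt hf0 hg hb (mul_pos ha hy₁) h1
  obtain ⟨x₂, l2, u2, g2, f2⟩ := lt_mul_pseudoInv hf hg0 hb hy₂ h2
  obtain ⟨x₁, l1, u1, f1, g1⟩ := mul_pseudoInv_lt hf0 hg hb (mul_pos ha hy₃) h3
  have hx12 : x₁ < x₂ := (u1.trans_le (antitone_pseudoInv g h23.le)).trans l2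
  have hx23 : x₂ < x₃ := by
    refine (u2.trans_le ?_).trans l3
    gcongr
    exact antitone_pseudoInv f (by gcongr)
  have hx₁ : 0 < x₁ := (mul_nonneg hb.le (pseudoInv_mem _).1).trans_lt l1
  have key := hfg (inv_pos.2 hb) (inv_pos.2 ha) hx₁ hx12 hx23
    (((inv_mul_lt_iff₀ ha).2 f1).trans_le g1) (g2.trans_le ((le_inv_mul_iff₀ ha).2 f2))
  exact absurd key (((inv_mul_lt_iff₀ ha).2 f3).trans_le g3).not_ge

/-- Since `T f` and `T g` agree at `0`, the first of the possible sign changes disappears. -/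
lemma CrossesTwice.T_le_of_lt {f g : ℝ → ℝ} (hf : f ∈ E) (hg : g ∈ E)
    (hfg : CrossesTwice (pseudoInv f) (pseudoInv g)) {a x₁ x₂ : ℝ} (ha : 0 < a)
    (hx₁ : 0 < x₁) (h12 : x₁ < x₂) (h1 : T g x₁ < T f (a * x₁)) : T g x₂ ≤ T f (a * x₂) := by
  by_contra! h2
  obtain ⟨c, M, k, hc, hM, hk, hint, heq⟩ := exists_integral_eq hf hg ha zero_lt_one
  simp only [one_mul] at heq
  have hx₂ : x₂ ≤ M := by
    by_contra! hlt
    rw [T_eq_zero hg (hM.trans hlt.le)] at h2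
    have h0 : T f (max 1 (a * x₂)) = 0 := T_eq_zero hf (le_max_left _ _)
    exact absurd (h0.symm.trans_le (antitone_T hf (le_max_right _ _))) h2.not_ge
  have e0 := heq 0
  rw [mul_zero, T_zero hf, T_zero hg, sub_self, mul_zero] at e0
  have e1 := mul_pos hk (sub_pos.2 h1)
  have e2 := mul_neg_of_pos_of_neg hk (sub_neg.2 h2)
  rw [← heq] at e1 e2
  have s1 := intervalIntegral.integral_add_adjacent_intervals (hint 0 x₁) (hint x₁ M)
  have s2 := intervalIntegral.integral_add_adjacent_intervals (hint x₁ x₂) (hint x₂ M)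
  obtain ⟨t₁, ht₁, hn₁⟩ := exists_neg_of_integral_neg hx₁.le (by linarith)
  obtain ⟨t₂, ht₂, hn₂⟩ := exists_pos_of_integral_pos h12.le (by linarith)
  obtain ⟨t₃, ht₃, hn₃⟩ := exists_neg_of_integral_neg hx₂ e2
  exact absurd (hfg ha hc ht₁.1 (ht₁.2.trans_lt ht₂.1) (ht₂.2.trans_lt ht₃.1)
    (sub_neg.1 hn₁) (sub_pos.1 hn₂)) (sub_neg.1 hn₃).not_ge

lemma CrossesTwice.T_T_le {f g : ℝ → ℝ} (hf : f ∈ E) (hg : g ∈ E)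
    (hfg : CrossesTwice (pseudoInv f) (pseudoInv g)) {x : ℝ}
    (hx : x ∈ Icc (0 : ℝ) 1) : T (T f) x ≤ T (T g) x := by
  by_contra! hlt
  have hF := T_mem_E hf
  have hG := T_mem_E hg
  obtain ⟨c, M, k, hc, hM, hk, hint, heq⟩ := exists_integral_eq hF hG zero_lt_one zero_lt_one
  simp only [one_mul] at heq hint
  have e0 := heq 0
  rw [T_zero hF, T_zero hG, sub_self, mul_zero] at e0
  have e1 := mul_pos hk (sub_pos.2 hlt)
  rw [← heq] at e1
  have s1 := intervalIntegral.integral_add_adjacent_intervals (hint 0 x) (hint x M)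
  obtain ⟨y₁, hy₁, hn₁⟩ := exists_neg_of_integral_neg hx.1 (by linarith)
  obtain ⟨y₂, hy₂, hn₂⟩ := exists_pos_of_integral_pos (hx.2.trans hM) e1
  have hy12 := hy₁.2.trans_lt hy₂.1
  obtain ⟨x₂, l2, u2, f2, g2⟩ := mul_pseudoInv_lt (fun x => T_eq_zero hf) hG hc hy₁.1
    (sub_neg.1 hn₁)
  obtain ⟨x₁, l1, u1, g1, f1⟩ := lt_mul_pseudoInv hF (fun x => T_eq_zero hg) hc
    (hy₁.1.trans hy12) (sub_pos.1 hn₂)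
  have hx12 : x₁ < x₂ := by
    refine (u1.trans_le ?_).trans l2
    gcongr
    exact antitone_pseudoInv _ hy12.le
  exact absurd (hfg.T_le_of_lt hf hg (inv_pos.2 hc) ((pseudoInv_mem _).1.trans_lt l1) hx12
    (g1.trans_le f1)) (f2.trans_le g2).not_ge

lemma h_mem_E (n : ℕ) : h n ∈ E := by
  induction n with
  | zero => exact ⟨antitoneOn_const, fun _ _ => by simp [h], rfl, by simp [h]⟩
  | succ n ih => exact T_mem_E ih

lemma crossesTwice_pseudoInv_h (n : ℕ) :
    CrossesTwice (pseudoInv (h (n + 1))) (pseudoInv (h n)) := by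
  induction n with
  | zero =>
    intro a b x₁ x₂ x₃ ha hb _ h12 h23 h1 h2
    rcases le_or_gt x₃ 1 with h3 | h3
    · have hone : ∀ x ≤ 1, pseudoInv (h 0) x = 1 := fun x hx =>
        le_antisymm (pseudoInv_mem x).2 (le_pseudoInv (right_mem_Icc.2 zero_le_one) hx)
      rw [hone _ (h12.le.trans (h23.le.trans h3))] at h1
      rw [hone _ (h23.le.trans h3)] at h2
      have : b * pseudoInv (h (0 + 1)) (a * x₂) ≤ b * pseudoInv (h (0 + 1)) (a * x₁) := by
        gcongr
        exact antitone_pseudoInv _ (by gcongr)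
      linarith
    · rw [pseudoInv_eq_zero (h_mem_E 0) h3]
      exact mul_nonneg hb.le (pseudoInv_mem _).1
  | succ n ih =>
    exact (ih.map_T (h_mem_E _) (h_mem_E _)).map_pseudoInv (h_mem_E _) (h_mem_E _)
      (fun x => T_eq_zero (h_mem_E _)) (fun x => T_eq_zero (h_mem_E _))

lemma le_one_sub_of_convexOn {F : ℝ → ℝ} (hF : ConvexOn ℝ (Icc 0 1) F) (h0 : F 0 = 1)
    (h1 : F 1 = 0) {x : ℝ} (hx : x ∈ Icc (0 : ℝ) 1) : F x ≤ 1 - x := by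
  have := hF.2 (left_mem_Icc.2 zero_le_one) (right_mem_Icc.2 zero_le_one)
    (sub_nonneg.2 hx.2) hx.1 (sub_add_cancel 1 x)
  simpa [h0, h1] using this

lemma h_one {x : ℝ} (hx : x ∈ Icc (0 : ℝ) 1) : h 1 x = 1 - x := by
  have hone : ∀ t ∈ uIcc x 1, pseudoInv (h 0) t = 1 := fun t ht => by
    rw [uIcc_of_le hx.2] at ht
    exact le_antisymm (pseudoInv_mem t).2 (le_pseudoInv (right_mem_Icc.2 zero_le_one) ht.2)
  have : h 1 x = (∫ t in x..1, pseudoInv (h 0) t) / ∫ t in (0 : ℝ)..1, h 0 t := rfl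
  rw [this, intervalIntegral.integral_congr hone]
  simp [h]

lemma h_succ_le (n : ℕ) {x : ℝ} (hx : x ∈ Icc (0 : ℝ) 1) : h (n + 1) x ≤ h n x := by
  match n with
  | 0 => exact ((h_mem_E 1).2.1 hx).2
  | 1 =>
    rw [h_one hx]
    exact le_one_sub_of_convexOn (convexOn_T (h_mem_E 1)) (T_zero (h_mem_E 1))
      (T_eq_zero (h_mem_E 1) le_rfl) hx
  | n + 2 => exact (crossesTwice_pseudoInv_h n).T_T_le (h_mem_E _) (h_mem_E _) hx

lemma κ_succ_le (n : ℕ) : κ (n + 1) ≤ κ n :=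
  intervalIntegral.integral_mono_on zero_le_one (intervalIntegrable_of_mem_E (h_mem_E _))
    (intervalIntegrable_of_mem_E (h_mem_E _)) fun _ hx => h_succ_le n hx

lemma κ_pos (n : ℕ) : 0 < κ n := (h_mem_E n).2.2.2

lemma κ_zero : κ 0 = 1 := by simp [κ, h]

lemma κ_le_one (n : ℕ) : κ n ≤ 1 :=
  (antitone_nat_of_succ_le κ_succ_le (Nat.zero_le n)).trans_eq κ_zero

lemma one_sub_div_le_h (n : ℕ) {x : ℝ} (hx : 0 ≤ x) : 1 - x / κ n ≤ h (n + 1) x := by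
  have h1 : ∫ t in (0 : ℝ)..x, pseudoInv (h n) t ≤ x := by
    have := intervalIntegral.integral_mono_on hx (intervalIntegrable_pseudoInv (h n) 0 x)
      intervalIntegrable_const fun t _ => (pseudoInv_mem (g := h n) t).2
    simpa using this
  have h2 : h (n + 1) 0 - h (n + 1) x = (∫ t in (0 : ℝ)..x, pseudoInv (h n) t) / κ n := T_sub 0 x
  have h3 : h (n + 1) 0 = 1 := T_zero (h_mem_E n)
  have h4 : (∫ t in (0 : ℝ)..x, pseudoInv (h n) t) / κ n ≤ x / κ n := by
    have := κ_pos n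
    gcongr
  linarith

/-- A linear lower bound near `0` for one iterate gives a quadratic one near `1` for the next. -/
lemma sq_le_h_of_linear_le {n : ℕ} {k : ℝ} (hk : 0 < k) (hk1 : k ≤ 1)
    (hn : ∀ x ∈ Icc (0 : ℝ) 1, 1 - x / k ≤ h n x) {x : ℝ} (hx : x ∈ Icc (0 : ℝ) 1) :
    k / (2 * κ n) * (1 - x) ^ 2 ≤ h (n + 1) x := by
  have hle : ∀ t ∈ Icc x 1, k * (1 - t) ≤ pseudoInv (h n) t := fun t ht => by
    have hmem : k * (1 - t) ∈ Icc (0 : ℝ) 1 :=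
      ⟨mul_nonneg hk.le (sub_nonneg.2 ht.2),
        mul_le_one₀ hk1 (sub_nonneg.2 ht.2) (by linarith [hx.1, ht.1])⟩
    refine le_pseudoInv hmem (le_trans (le_of_eq ?_) (hn _ hmem))
    field_simp
    ring
  have h1 := intervalIntegral.integral_mono_on hx.2
    (Continuous.intervalIntegrable (by fun_prop) x 1) (intervalIntegrable_pseudoInv (h n) x 1) hle
  have h2 : ∫ t in x..1, k * (1 - t) = k / 2 * (1 - x) ^ 2 := by
    rw [intervalIntegral.integral_const_mul, intervalIntegral.integral_sub (by simp) (by simp)]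
    simp
    ring
  have h3 : h (n + 1) x = (∫ t in x..1, pseudoInv (h n) t) / κ n := rfl
  rw [h3, le_div_iff₀ (κ_pos n)]
  refine le_trans (le_of_eq ?_) (h2.symm.trans_le h1)
  have := κ_pos n
  field_simp

lemma one_div_six_le_κ (n : ℕ) : 1 / 6 ≤ κ n := by
  rcases n with _ | n
  · rw [κ_zero]
    norm_num
  have hle : ∫ x in (0 : ℝ)..1, κ n / (2 * κ (n + 1)) * (1 - x) ^ 2 ≤ κ (n + 2) :=
    intervalIntegral.integral_mono_on zero_le_one
      (Continuous.intervalIntegrable (by fun_prop) 0 1) (intervalIntegrable_of_mem_E (h_mem_E _))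
      fun x hx => sq_le_h_of_linear_le (κ_pos n) (κ_le_one n)
        (fun x hx => one_sub_div_le_h n hx.1) hx
  have hint : ∫ x in (0 : ℝ)..1, (1 - x) ^ 2 = 1 / 3 := by
    rw [intervalIntegral.integral_comp_sub_left (fun x => x ^ 2) 1]
    norm_num [integral_pow]
  rw [intervalIntegral.integral_const_mul, hint] at hle
  have h1 := (hle.trans (κ_succ_le (n + 1))).trans (κ_succ_le n)
  have hp := κ_pos n
  have hp1 := κ_pos (n + 1)
  rw [div_mul_eq_mul_div, div_le_iff₀ (by positivity)] at h1
  nlinarith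

lemma one_sub_six_mul_le_h (n : ℕ) {x : ℝ} (hx : 0 ≤ x) : 1 - 6 * x ≤ h n x := by
  rcases n with _ | n
  · simp [h, hx]
  · refine le_trans ?_ (one_sub_div_le_h n hx)
    have : x / κ n ≤ x / (1 / 6) := by
      gcongr
      exact one_div_six_le_κ n
    linarith

lemma sq_div_le_h (n : ℕ) {x : ℝ} (hx : x ∈ Icc (0 : ℝ) 1) : (1 - x) ^ 2 / 12 ≤ h n x := by
  rcases n with _ | n
  · have : h 0 x = 1 := rfl
    nlinarith [hx.1, hx.2]
  · refine le_trans ?_ (sq_le_h_of_linear_le (k := 1 / 6) (by norm_num) (by norm_num)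
      (fun x hx => ?_) hx)
    · rw [div_eq_inv_mul]
      gcongr
      rw [le_div_iff₀ (mul_pos two_pos (κ_pos n))]
      linarith [κ_le_one n]
    · refine le_trans (le_of_eq ?_) (one_sub_six_mul_le_h n hx.1)
      ring

lemma bijOn_strictAntiOn_of_convexOn {F : ℝ → ℝ} (hF : ConvexOn ℝ (Icc 0 1) F) (h0 : F 0 = 1)
    (h1 : F 1 = 0) {C : ℝ} (hC : ∀ x ∈ Icc (0 : ℝ) 1, 1 - C * x ≤ F x)
    (hpos : ∀ x ∈ Ico (0 : ℝ) 1, 0 < F x) :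
    BijOn F (Icc 0 1) (Icc 0 1) ∧ StrictAntiOn F (Icc 0 1) := by
  have hnn : ∀ x ∈ Icc (0 : ℝ) 1, 0 ≤ F x := fun x hx => by
    rcases hx.2.eq_or_lt with rfl | hlt
    · exact h1.ge
    · exact (hpos x ⟨hx.1, hlt⟩).le
  have hle : ∀ x ∈ Icc (0 : ℝ) 1, F x ≤ 1 - x := fun x hx => le_one_sub_of_convexOn hF h0 h1 hx
  have hanti : StrictAntiOn F (Icc 0 1) := by
    intro x hx y hy hxy
    have hx1 : x < 1 := hxy.trans_le hy.2
    have hd : 0 < 1 - x := sub_pos.2 hx1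
    have := hF.2 hx (right_mem_Icc.2 zero_le_one)
      (div_nonneg (sub_nonneg.2 hy.2) hd.le : 0 ≤ (1 - y) / (1 - x))
      (div_nonneg (sub_pos.2 hxy).le hd.le : 0 ≤ (y - x) / (1 - x)) (by field_simp; ring)
    have he : ((1 - y) / (1 - x)) • x + ((y - x) / (1 - x)) • (1 : ℝ) = y := by
      simp only [smul_eq_mul]
      field_simp
      ring
    rw [he, h1, smul_zero, add_zero, smul_eq_mul] at this
    refine this.trans_lt ?_
    have hq : (1 - y) / (1 - x) < 1 := (div_lt_one hd).2 (by linarith)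
    exact mul_lt_of_lt_one_left (hpos x ⟨hx.1, hx1⟩) hq
  have hcont : ContinuousOn F (Icc 0 1) := by
    intro x hx
    rcases hx.1.eq_or_lt with rfl | hx0
    · rw [ContinuousWithinAt, h0]
      refine tendsto_of_tendsto_of_tendsto_of_le_of_le' (g := fun x => 1 - C * x)
        (h := fun x => 1 - x) ?_ ?_ (eventually_mem_nhdsWithin.mono hC)
        (eventually_mem_nhdsWithin.mono hle)
      · have : Continuous fun x : ℝ => 1 - C * x := by fun_prop
        simpa using (this.tendsto 0).mono_left nhdsWithin_le_nhds
      · have : Continuous fun x : ℝ => 1 - x := by fun_prop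
        simpa using (this.tendsto 0).mono_left nhdsWithin_le_nhds
    rcases hx.2.eq_or_lt with rfl | hx1
    · rw [ContinuousWithinAt, h1]
      refine tendsto_of_tendsto_of_tendsto_of_le_of_le' (g := fun _ => 0)
        (h := fun x => 1 - x) tendsto_const_nhds ?_ (eventually_mem_nhdsWithin.mono hnn)
        (eventually_mem_nhdsWithin.mono hle)
      have : Continuous fun x : ℝ => 1 - x := by fun_prop
      simpa using (this.tendsto 1).mono_left nhdsWithin_le_nhds
    · have := hF.continuousOn_interior
      rw [interior_Icc] at this
      exact (this.continuousAt (Ioo_mem_nhds hx0 hx1)).continuousWithinAt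
  refine ⟨⟨fun x hx => ⟨hnn x hx, (hle x hx).trans (sub_le_self 1 hx.1)⟩, hanti.injOn, ?_⟩, hanti⟩
  have := intermediate_value_Icc' zero_le_one hcont
  rwa [h0, h1] at this

open Filter Topology in
lemma tendsto_h {x : ℝ} (hx : x ∈ Icc (0 : ℝ) 1) :
    Tendsto (fun n => h n x) atTop (𝓝 (⨅ n, h n x)) :=
  tendsto_atTop_ciInf (antitone_nat_of_succ_le fun n => h_succ_le n hx)
    ⟨0, by rintro _ ⟨n, rfl⟩; exact ((h_mem_E n).2.1 hx).1⟩

lemma convexOn_h (n : ℕ) : ConvexOn ℝ (Icc 0 1) (h n) := by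
  rcases n with _ | n
  · exact convexOn_const 1 (convex_Icc 0 1)
  · exact convexOn_T (h_mem_E n)

lemma convexOn_iInf_h : ConvexOn ℝ (Icc 0 1) (fun x => ⨅ n : ℕ, h n x) := by
  refine ⟨convex_Icc 0 1, fun x hx y hy a b ha hb hab => ?_⟩
  exact le_of_tendsto_of_tendsto' (tendsto_h (convex_Icc 0 1 hx hy ha hb hab))
    (((tendsto_h hx).const_smul a).add ((tendsto_h hy).const_smul b))
    fun n => (convexOn_h n).2 hx hy ha hb hab

/-- h = inf_n (h n) and each h n (n ≥ 1) are bijective [0,1] → [0,1],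
strictly decreasing and convex. -/
theorem stmt14 :
    (BijOn (fun x => ⨅ n : ℕ, h n x) (Icc 0 1) (Icc 0 1) ∧
      StrictAntiOn (fun x => ⨅ n : ℕ, h n x) (Icc 0 1) ∧
      ConvexOn ℝ (Icc 0 1) (fun x => ⨅ n : ℕ, h n x)) ∧
    ∀ n : ℕ, 1 ≤ n →
      BijOn (h n) (Icc 0 1) (Icc 0 1) ∧
      StrictAntiOn (h n) (Icc 0 1) ∧
      ConvexOn ℝ (Icc 0 1) (h n) := by
  have hpos : ∀ x ∈ Ico (0 : ℝ) 1, 0 < (1 - x) ^ 2 / 12 := fun x hx => by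
    have := sub_pos.2 hx.2
    positivity
  refine ⟨?_, fun n hn => ?_⟩
  · have h0 : ⨅ n : ℕ, h n 0 = 1 := by
      simp only [fun n => (h_mem_E n).2.2.1, ciInf_const]
    have h1 : ⨅ n : ℕ, h n 1 = 0 :=
      tendsto_nhds_unique (tendsto_h (right_mem_Icc.2 zero_le_one)) <|
        tendsto_const_nhds.congr' <| (Filter.eventually_ge_atTop 1).mono fun n hn => by
          obtain ⟨m, rfl⟩ := Nat.exists_eq_add_of_le' hn
          exact (T_eq_zero (h_mem_E m) le_rfl).symm
    have := bijOn_strictAntiOn_of_convexOn convexOn_iInf_h h0 h1 (C := 6)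
      (fun x hx => le_ciInf fun n => one_sub_six_mul_le_h n hx.1)
      fun x hx => (hpos x hx).trans_le (le_ciInf fun n => sq_div_le_h n ⟨hx.1, hx.2.le⟩)
    exact ⟨this.1, this.2, convexOn_iInf_h⟩
  · obtain ⟨m, rfl⟩ := Nat.exists_eq_add_of_le' hn
    have := bijOn_strictAntiOn_of_convexOn (convexOn_h (m + 1)) (T_zero (h_mem_E m))
      (T_eq_zero (h_mem_E m) le_rfl) (C := 6) (fun x hx => one_sub_six_mul_le_h _ hx.1)
      fun x hx => (hpos x hx).trans_le (sq_div_le_h _ ⟨hx.1, hx.2.le⟩)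
    exact ⟨this.1, this.2, convexOn_h _⟩
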